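/- arXiv:1306.4553 — 4 statements merged into one kernel-verified Lean document; each statement's English description precedes it below -/
import Mathlib

section
/- Let n ≥ 2 be an integer and let p₀,…,p_{n−1} ∈ ℝ^{1,n} be n points in general position. Then there exists a C∞ diffeomorphism h : ℝ^{1,n} → ℝ^{1,n} such that for every regular value y of L_{(p₀,…,p_{n−1})}, the image h(L_{(p₀,…,p_{n−1})}^{−1}(y)) of the non-singular fiber is an equilateral hyperbola, if and only if the recognition subspace V(p₀,…,p_{n−1}) is space-like. -/
open scoped BigOperators

noncomputable section

/-- The Lorentzian inner product on `ℝ^{1,n}`, modeled as `Fin (n+1) → ℝ`: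
`⟨x,y⟩ = -x₀y₀ + x₁y₁ + ⋯ + xₙyₙ`. -/
def lorIP {n : ℕ} (x y : Fin (n + 1) → ℝ) : ℝ :=
  (∑ i, x i * y i) - 2 * (x 0 * y 0)

/-- The Euclidean inner product on `Fin m → ℝ`. -/
def eucIP {m : ℕ} (x y : Fin m → ℝ) : ℝ := ∑ i, x i * y i

/-- The Lorentzian distance-squared mapping determined by the points `p 0, …, p (m-1)`. -/
def LorDSM {n m : ℕ} (p : Fin m → Fin (n + 1) → ℝ) :
    (Fin (n + 1) → ℝ) → (Fin m → ℝ) :=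
  fun x i => lorIP (x - p i) (x - p i)

/-- The Euclidean distance-squared mapping determined by the points `p 0, …, p (m-1)`. -/
def EucDSM {n m : ℕ} (p : Fin m → Fin (n + 1) → ℝ) :
    (Fin (n + 1) → ℝ) → (Fin m → ℝ) :=
  fun x i => eucIP (x - p i) (x - p i)

/-- The recognition subspace `V(p₀, …, p_k)`: the span of the vectors `p i - p 0`. -/
def recSub {n k : ℕ} (p : Fin (k + 1) → Fin (n + 1) → ℝ) :
    Submodule ℝ (Fin (n + 1) → ℝ) :=
  Submodule.span ℝ (Set.range fun i => p i - p 0)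

/-- The partial recognition subspace `V(p₀, …, p_j)`: the span of `p i - p 0` for `i ≤ j`. -/
def recSubUpTo {n k : ℕ} (p : Fin (k + 1) → Fin (n + 1) → ℝ) (j : ℕ) :
    Submodule ℝ (Fin (n + 1) → ℝ) :=
  Submodule.span ℝ {v | ∃ i : Fin (k + 1), (i : ℕ) ≤ j ∧ v = p i - p 0}

/-- A subspace is time-like iff it contains a vector of negative Lorentzian square. -/
def LTimeLike {n : ℕ} (V : Submodule ℝ (Fin (n + 1) → ℝ)) : Prop :=
  ∃ v ∈ V, lorIP v v < 0

/-- A subspace is space-like iff every nonzero vector in it has positive Lorentzian square. -/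
def LSpaceLike {n : ℕ} (V : Submodule ℝ (Fin (n + 1) → ℝ)) : Prop :=
  ∀ v ∈ V, v ≠ 0 → 0 < lorIP v v

/-- A subspace is light-like iff it is neither time-like nor space-like. -/
def LLightLike {n : ℕ} (V : Submodule ℝ (Fin (n + 1) → ℝ)) : Prop :=
  ¬ LTimeLike V ∧ ¬ LSpaceLike V

/-- `f` and `g` are `𝒜`-equivalent: `g = H ∘ f ∘ h` for `C^∞` diffeomorphisms `h, H`. -/
def AEquiv {a b : ℕ} (f g : (Fin a → ℝ) → (Fin b → ℝ)) : Prop :=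
  ∃ (h : (Fin a → ℝ) ≃ (Fin a → ℝ)) (H : (Fin b → ℝ) ≃ (Fin b → ℝ)),
    ContDiff ℝ (⊤ : ℕ∞) ⇑h ∧ ContDiff ℝ (⊤ : ℕ∞) ⇑h.symm ∧
    ContDiff ℝ (⊤ : ℕ∞) ⇑H ∧ ContDiff ℝ (⊤ : ℕ∞) ⇑H.symm ∧
    g = ⇑H ∘ f ∘ ⇑h

/-- `y` is a regular value of `f`: the differential of `f` is surjective at
every point of the fiber `f⁻¹(y)`. -/
def IsRegularValue {a b : ℕ} (f : (Fin a → ℝ) → (Fin b → ℝ)) (y : Fin b → ℝ) : Prop :=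
  ∀ x, f x = y → Function.Surjective ⇑(fderiv ℝ f x)

/-- `S` is an equilateral hyperbola in `Fin m → ℝ` (for the Euclidean structure). -/
def IsEquilateralHyperbola {m : ℕ} (S : Set (Fin m → ℝ)) : Prop :=
  ∃ (c e₁ e₂ : Fin m → ℝ) (a : ℝ), a ≠ 0 ∧
    eucIP e₁ e₁ = 1 ∧ eucIP e₂ e₂ = 1 ∧ eucIP e₁ e₂ = 0 ∧
    S = {x | ∃ s t : ℝ, s ^ 2 - t ^ 2 = a ^ 2 ∧ x = c + s • e₁ + t • e₂}

/-- The Lorentzian inner product as a bilinear form. -/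
def lorForm (n : ℕ) : LinearMap.BilinForm ℝ (Fin (n + 1) → ℝ) :=
  LinearMap.mk₂ ℝ lorIP
    (fun x y z => by simp [lorIP, add_mul, Finset.sum_add_distrib]; ring)
    (fun c x y => by simp [lorIP, mul_assoc, ← Finset.mul_sum]; ring)
    (fun x y z => by simp [lorIP, mul_add, Finset.sum_add_distrib]; ring)
    (fun c x y => by simp [lorIP, mul_left_comm, ← Finset.mul_sum]; ring)

@[simp]
theorem lorForm_apply {n : ℕ} (x y : Fin (n + 1) → ℝ) : lorForm n x y = lorIP x y := rfl

theorem lorForm_isSymm (n : ℕ) : (lorForm n).IsSymm :=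
  ⟨fun x y => by simp [lorIP, mul_comm]⟩

theorem lorIP_comm {n : ℕ} (x y : Fin (n + 1) → ℝ) : lorIP x y = lorIP y x := by
  simp [lorIP, mul_comm]

theorem lorIP_add_left {n : ℕ} (x y z : Fin (n + 1) → ℝ) :
    lorIP (x + y) z = lorIP x z + lorIP y z := by
  simp [← lorForm_apply]

theorem lorIP_sub_left {n : ℕ} (x y z : Fin (n + 1) → ℝ) :
    lorIP (x - y) z = lorIP x z - lorIP y z := by
  simp [← lorForm_apply]

theorem lorIP_add_right {n : ℕ} (x y z : Fin (n + 1) → ℝ) :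
    lorIP x (y + z) = lorIP x y + lorIP x z := by
  simp [← lorForm_apply]

theorem lorIP_sub_right {n : ℕ} (x y z : Fin (n + 1) → ℝ) :
    lorIP x (y - z) = lorIP x y - lorIP x z := by
  simp [← lorForm_apply]

theorem lorIP_smul_left {n : ℕ} (c : ℝ) (x y : Fin (n + 1) → ℝ) :
    lorIP (c • x) y = c * lorIP x y := by
  simp [← lorForm_apply]

theorem lorIP_smul_right {n : ℕ} (c : ℝ) (x y : Fin (n + 1) → ℝ) :
    lorIP x (c • y) = c * lorIP x y := by
  simp [← lorForm_apply]

theorem eucIP_self_pos {m : ℕ} {x : Fin m → ℝ} (hx : x ≠ 0) : 0 < eucIP x x := by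
  obtain ⟨i, hi⟩ := Function.ne_iff.1 hx
  exact Finset.sum_pos' (fun j _ => mul_self_nonneg _)
    ⟨i, Finset.mem_univ i, mul_self_pos.2 hi⟩

theorem eucIP_single_one_left {m : ℕ} (i : Fin m) (x : Fin m → ℝ) :
    eucIP (Pi.single i 1) x = x i := by
  simp [eucIP, Pi.single_apply]

/-- Reversing the sign of the time coordinate turns the Lorentzian inner product with a vector
into the Euclidean one. -/
theorem exists_lorIP_eq_eucIP {n : ℕ} (x : Fin (n + 1) → ℝ) :
    ∃ y, ∀ z, lorIP y z = eucIP x z := by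
  refine ⟨Function.update x 0 (-x 0), fun z => ?_⟩
  simp [lorIP, eucIP, Fin.sum_univ_succ]
  ring

theorem eq_zero_of_lorIP_eq_zero {n : ℕ} {x : Fin (n + 1) → ℝ} (h : ∀ y, lorIP x y = 0) :
    x = 0 := by
  by_contra hx
  obtain ⟨y, hy⟩ := exists_lorIP_eq_eucIP x
  exact (eucIP_self_pos hx).ne' (by rw [← hy, lorIP_comm, h])

theorem lorForm_nondegenerate (n : ℕ) : (lorForm n).Nondegenerate :=
  ⟨fun _ h => eq_zero_of_lorIP_eq_zero h,
    fun _ h => eq_zero_of_lorIP_eq_zero fun y => by rw [lorIP_comm]; exact h y⟩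

/-- A quantitative form of the fact that the orthogonal complement of a time-like vector is
space-like. -/
theorem neg_lorIP_self_mul_eucIP_le {n : ℕ} {u z : Fin (n + 1) → ℝ} (h : lorIP u z = 0) :
    -lorIP u u * eucIP z z ≤ eucIP u u * lorIP z z := by
  have cs := Finset.sum_mul_sq_le_sq_mul_sq Finset.univ
    (fun i : Fin n => u i.succ) (fun i => z i.succ)
  simp only [lorIP, eucIP, Fin.sum_univ_succ, ← sq] at *
  have : ∑ i : Fin n, u i.succ * z i.succ = u 0 * z 0 := by linarith
  rw [this] at cs
  nlinarith

theorem lorIP_self_pos_of_orthogonal {n : ℕ} {u z : Fin (n + 1) → ℝ} (hu : lorIP u u < 0)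
    (h : lorIP u z = 0) (hz : z ≠ 0) : 0 < lorIP z z := by
  have h1 := neg_lorIP_self_mul_eucIP_le h
  have hu0 : u ≠ 0 := by
    rintro rfl
    simp [lorIP] at hu
  have h2 := mul_pos (neg_pos.2 hu) (eucIP_self_pos hz)
  exact pos_of_mul_pos_right (h2.trans_le h1) (eucIP_self_pos hu0).le

theorem eucIP_hyperbola_left {m : ℕ} {c e₁ e₂ : Fin m → ℝ} (h₁ : eucIP e₁ e₁ = 1)
    (h₁₂ : eucIP e₁ e₂ = 0) (s t : ℝ) :
    eucIP e₁ (c + s • e₁ + t • e₂ - c) = s := by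
  have : eucIP e₁ (c + s • e₁ + t • e₂ - c) = s * eucIP e₁ e₁ + t * eucIP e₁ e₂ := by
    simp only [eucIP, Finset.mul_sum, ← Finset.sum_add_distrib]
    refine Finset.sum_congr rfl fun i _ => ?_
    simp
    ring
  rw [this, h₁, h₁₂]
  ring

theorem continuous_eucIP_sub {m : ℕ} (e c : Fin m → ℝ) :
    Continuous fun x => eucIP e (x - c) := by
  unfold eucIP
  fun_prop

theorem IsEquilateralHyperbola.not_isPreconnected {m : ℕ} {S : Set (Fin m → ℝ)}
    (hS : IsEquilateralHyperbola S) : ¬ IsPreconnected S := by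
  obtain ⟨c, e₁, e₂, a, ha, h₁, -, h₁₂, rfl⟩ := hS
  intro hc
  have him := (hc.image _ (continuous_eucIP_sub e₁ c).continuousOn).ordConnected
  have hmem : ∀ s, s ^ 2 = a ^ 2 → s ∈ (fun x => eucIP e₁ (x - c)) ''
      {x | ∃ s t : ℝ, s ^ 2 - t ^ 2 = a ^ 2 ∧ x = c + s • e₁ + t • e₂} := fun s hs =>
    ⟨_, ⟨s, 0, by simpa using hs, rfl⟩, eucIP_hyperbola_left h₁ h₁₂ s 0⟩
  obtain ⟨_, ⟨s, t, hst, rfl⟩, h0⟩ := him.out (hmem (-|a|) (by simp)) (hmem |a| (by simp))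
    (show (0 : ℝ) ∈ Set.Icc (-|a|) |a| by simp)
  have hs : s = 0 := (eucIP_hyperbola_left h₁ h₁₂ s t).symm.trans h0
  have := pow_pos (abs_pos.2 ha) 2
  rw [sq_abs] at this
  nlinarith

theorem IsEquilateralHyperbola.not_isCompact {m : ℕ} {S : Set (Fin m → ℝ)}
    (hS : IsEquilateralHyperbola S) : ¬ IsCompact S := by
  obtain ⟨c, e₁, e₂, a, -, h₁, -, h₁₂, rfl⟩ := hS
  intro hc
  obtain ⟨M, hM⟩ := (hc.image (continuous_eucIP_sub e₁ c)).bddAbove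
  have hs := Real.sq_sqrt (show 0 ≤ a ^ 2 + (|M| + 1) ^ 2 by positivity)
  have hle := hM ⟨_, ⟨√(a ^ 2 + (|M| + 1) ^ 2), |M| + 1, by rw [hs]; ring, rfl⟩,
    eucIP_hyperbola_left h₁ h₁₂ _ _⟩
  have hge : |M| + 1 ≤ √(a ^ 2 + (|M| + 1) ^ 2) :=
    Real.le_sqrt_of_sq_le (by nlinarith [sq_nonneg a])
  linarith [le_abs_self M]

/-- Any two finite linearly independent families with the same index set are related by a linear
automorphism. -/
theorem exists_linearEquiv_apply_eq {K E ι : Type*} [Field K] [AddCommGroup E] [Module K E]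
    [FiniteDimensional K E] {v w : ι → E} (hv : LinearIndependent K v)
    (hw : LinearIndependent K w) : ∃ e : E ≃ₗ[K] E, ∀ i, e (v i) = w i := by
  obtain ⟨S, hS⟩ := (Submodule.span K (Set.range v)).exists_isCompl
  obtain ⟨T, hT⟩ := (Submodule.span K (Set.range w)).exists_isCompl
  let f := (Module.Basis.span hv).equiv (Module.Basis.span hw) (Equiv.refl ι)
  have hST : Module.finrank K S = Module.finrank K T := by
    have h1 := Submodule.finrank_add_eq_of_isCompl hS
    have h2 := Submodule.finrank_add_eq_of_isCompl hT
    have h3 := f.finrank_eq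
    omega
  let g := LinearEquiv.ofFinrankEq S T hST
  refine ⟨(Submodule.prodEquivOfIsCompl _ _ hS).symm ≪≫ₗ f.prodCongr g ≪≫ₗ
    Submodule.prodEquivOfIsCompl _ _ hT, fun i => ?_⟩
  have hi : v i = Module.Basis.span hv i := by rw [Module.Basis.span_apply]
  rw [LinearEquiv.trans_apply, LinearEquiv.trans_apply, hi,
    Submodule.prodEquivOfIsCompl_symm_apply_left]
  change ((f (Module.Basis.span hv i) : E) + ((g 0 : T) : E)) = w i
  rw [Module.Basis.equiv_apply, Module.Basis.span_apply]
  simp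

section Fibers

variable {n m : ℕ} (p : Fin m → Fin (n + 1) → ℝ)

theorem hasFDerivAt_lorDSM (x : Fin (n + 1) → ℝ) :
    HasFDerivAt (LorDSM p)
      (ContinuousLinearMap.pi fun i =>
        (2 : ℝ) • (lorForm n).toContinuousBilinearMap (x - p i)) x := by
  rw [hasFDerivAt_pi]
  intro i
  have hd := (hasFDerivAt_id (𝕜 := ℝ) x).sub_const (p i)
  have := (lorForm n).toContinuousBilinearMap.hasFDerivAt_of_bilinear hd hd
  refine this.congr_fderiv (ContinuousLinearMap.ext fun v => ?_)
  change lorIP (x - p i) v + lorIP v (x - p i) = 2 * lorIP (x - p i) v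
  rw [lorIP_comm v]
  ring

theorem continuous_lorDSM : Continuous (LorDSM p) :=
  continuous_iff_continuousAt.2 fun x => (hasFDerivAt_lorDSM p x).continuousAt

theorem surjective_fderiv_lorDSM_iff (x : Fin (n + 1) → ℝ) :
    Function.Surjective (fderiv ℝ (LorDSM p) x) ↔ LinearIndependent ℝ fun i => x - p i := by
  have happ : ∀ v i, fderiv ℝ (LorDSM p) x v i = 2 * lorIP (x - p i) v := by
    intro v i
    rw [(hasFDerivAt_lorDSM p x).fderiv]
    rfl
  have hpair : ∀ (c : Fin m → ℝ) v,
      ∑ i, c i * fderiv ℝ (LorDSM p) x v i = 2 * lorIP (∑ i, c i • (x - p i)) v := by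
    intro c v
    simp only [happ, ← lorForm_apply, map_sum, LinearMap.sum_apply, Finset.mul_sum, map_smul,
      LinearMap.smul_apply, smul_eq_mul]
    exact Finset.sum_congr rfl fun i _ => by ring
  rw [Fintype.linearIndependent_iff]
  constructor
  · intro hs c hc
    obtain ⟨v, hv⟩ := hs c
    have := hpair c v
    rw [hc, hv] at this
    by_contra! hne
    obtain ⟨i, hi⟩ := hne
    refine (eucIP_self_pos (x := c) fun h => hi (congrFun h i)).ne' (this.trans ?_)
    simp [lorIP]
  · intro hli
    by_contra hs
    have hlt : LinearMap.range (fderiv ℝ (LorDSM p) x).toLinearMap < ⊤ :=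
      lt_top_iff_ne_top.2 fun h => hs (LinearMap.range_eq_top.1 h)
    obtain ⟨f, hf, hker⟩ := Submodule.exists_le_ker_of_lt_top _ hlt
    have hfc : ∀ w, f w = ∑ i, f (Pi.single i 1) * w i := by
      intro w
      conv_lhs => rw [pi_eq_sum_univ' w]
      simp [map_sum, mul_comm]
    have hzero := hli (fun i => f (Pi.single i 1)) <| eq_zero_of_lorIP_eq_zero fun v => by
      have h1 := hpair (fun i => f (Pi.single i 1)) v
      have h2 : f (fderiv ℝ (LorDSM p) x v) = 0 := hker ⟨v, rfl⟩
      rw [← hfc, h2] at h1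
      linarith
    exact hf (LinearMap.ext fun w => by
      rw [hfc]
      exact Finset.sum_eq_zero fun i _ => by rw [hzero i, zero_mul])

variable {p} {o : Fin m}

theorem surjective_fderiv_lorDSM_iff_notMem
    (hgen : Module.finrank ℝ (Submodule.span ℝ (Set.range fun i => p i - p o)) = m - 1)
    (x : Fin (n + 1) → ℝ) :
    Function.Surjective (fderiv ℝ (LorDSM p) x) ↔
      x - p o ∉ Submodule.span ℝ (Set.range fun i => p i - p o) := by
  have hm : 0 < m := o.pos
  set V := Submodule.span ℝ (Set.range fun i => p i - p o)
  rw [surjective_fderiv_lorDSM_iff, linearIndependent_iff_card_eq_finrank_span, Fintype.card_fin,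
    Set.finrank]
  have hpV : ∀ i, p i - p o ∈ V := fun i => Submodule.subset_span ⟨i, rfl⟩
  constructor
  · intro h hx
    have hle : Submodule.span ℝ (Set.range fun i => x - p i) ≤ V := by
      rw [Submodule.span_le]
      rintro _ ⟨i, rfl⟩
      simpa using V.sub_mem hx (hpV i)
    have := Submodule.finrank_mono hle
    omega
  · intro hx
    have hmem : ∀ i, x - p i ∈ Submodule.span ℝ (Set.range fun i => x - p i) :=
      fun i => Submodule.subset_span ⟨i, rfl⟩
    have hlt : V < Submodule.span ℝ (Set.range fun i => x - p i) := by
      refine lt_of_le_of_ne (Submodule.span_le.2 ?_) fun h => hx (h ▸ hmem o)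
      rintro _ ⟨i, rfl⟩
      simpa using Submodule.sub_mem _ (hmem o) (hmem i)
    have h1 := Submodule.finrank_lt_finrank_of_lt hlt
    have h2 := finrank_range_le_card (R := ℝ) fun i => x - p i
    rw [Set.finrank, Fintype.card_fin] at h2
    omega

theorem mem_orthogonal_span_iff {ι : Type*} {v : ι → Fin (n + 1) → ℝ} {z : Fin (n + 1) → ℝ} :
    z ∈ (lorForm n).orthogonal (Submodule.span ℝ (Set.range v)) ↔ ∀ i, lorIP (v i) z = 0 := by
  constructor
  · exact fun h i => h _ (Submodule.subset_span ⟨i, rfl⟩)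
  · intro h w hw
    induction hw using Submodule.span_induction with
    | mem w hw => obtain ⟨i, rfl⟩ := hw; exact h i
    | zero => exact LinearMap.map_zero₂ _ _
    | add a b _ _ ha hb => exact (lorIP_add_left a b z).trans (by
        rw [show lorIP a z = 0 from ha, show lorIP b z = 0 from hb, add_zero])
    | smul c a _ ha => exact (lorIP_smul_left c a z).trans (by
        rw [show lorIP a z = 0 from ha, mul_zero])

theorem lorDSM_eq_iff (o : Fin m) (x x' : Fin (n + 1) → ℝ) :
    LorDSM p x = LorDSM p x' ↔
      x - x' ∈ (lorForm n).orthogonal (Submodule.span ℝ (Set.range fun i => p i - p o)) ∧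
        lorIP (x - p o) (x - p o) = lorIP (x' - p o) (x' - p o) := by
  rw [mem_orthogonal_span_iff, funext_iff]
  have key : ∀ i, LorDSM p x i - LorDSM p x' i + 2 * lorIP (p i - p o) (x - x') =
      lorIP (x - p o) (x - p o) - lorIP (x' - p o) (x' - p o) := by
    intro i
    simp only [LorDSM, lorIP_sub_left, lorIP_sub_right, lorIP_comm _ (p i), lorIP_comm _ (p o)]
    ring
  constructor
  · intro h
    have ho : lorIP (x - p o) (x - p o) = lorIP (x' - p o) (x' - p o) := h o
    exact ⟨fun i => by linarith [key i, h i], ho⟩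
  · rintro ⟨h, ho⟩ i
    linarith [key i, h i]

/-- For a time-like recognition subspace, some non-singular fiber is compact. -/
theorem exists_isCompact_fiber_of_timeLike (hmn : m ≤ n)
    (hgen : Module.finrank ℝ (Submodule.span ℝ (Set.range fun i => p i - p o)) = m - 1)
    (hV : LTimeLike (Submodule.span ℝ (Set.range fun i => p i - p o))) :
    ∃ x, IsRegularValue (LorDSM p) (LorDSM p x) ∧ IsCompact (LorDSM p ⁻¹' {LorDSM p x}) := by
  obtain ⟨u, huV, hu⟩ := hV
  set V := Submodule.span ℝ (Set.range fun i => p i - p o)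
  have hfr : 0 < Module.finrank ℝ ((lorForm n).orthogonal V) := by
    rw [LinearMap.BilinForm.finrank_orthogonal (lorForm_nondegenerate n), hgen]
    simp
    omega
  obtain ⟨w, hw, hw0⟩ := (Submodule.ne_bot_iff _).1 (Submodule.one_le_finrank_iff.1 hfr)
  have hwpos : 0 < lorIP w w := lorIP_self_pos_of_orthogonal hu (hw u huV) hw0
  have hfib : ∀ x, LorDSM p x = LorDSM p (p o + w) →
      x - p o ∈ (lorForm n).orthogonal V ∧ lorIP (x - p o) (x - p o) = lorIP w w := by
    intro x hx
    rw [lorDSM_eq_iff o, add_sub_cancel_left] at hx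
    refine ⟨?_, hx.2⟩
    convert add_mem hx.1 hw using 1
    abel
  refine ⟨p o + w, fun x hx => ?_, ?_⟩
  · rw [surjective_fderiv_lorDSM_iff_notMem hgen]
    intro hxV
    obtain ⟨h1, h2⟩ := hfib x hx
    have h3 : lorIP (x - p o) (x - p o) = 0 := h1 _ hxV
    exact hwpos.ne' (h2.symm.trans h3)
  · set M := eucIP u u * lorIP w w / -lorIP u u with hM
    refine (isCompact_closedBall (p o) (√M)).of_isClosed_subset
      (isClosed_singleton.preimage (continuous_lorDSM p)) fun x hx => ?_
    obtain ⟨h1, h2⟩ := hfib x hx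
    have hle : eucIP (x - p o) (x - p o) ≤ M := by
      rw [hM, le_div_iff₀ (neg_pos.2 hu), ← h2, mul_comm]
      exact neg_lorIP_self_mul_eucIP_le (h1 u huV)
    rw [Metric.mem_closedBall, dist_pi_le_iff (Real.sqrt_nonneg _)]
    intro i
    refine Real.abs_le_sqrt (le_trans ?_ hle)
    rw [sq]
    exact Finset.single_le_sum (f := fun i => (x - p o) i * (x - p o) i)
      (fun j _ => mul_self_nonneg _) (Finset.mem_univ i)

/-- For a light-like recognition subspace, some non-singular fiber is connected. -/
theorem exists_isPreconnected_fiber_of_lightLike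
    (hgen : Module.finrank ℝ (Submodule.span ℝ (Set.range fun i => p i - p o)) = m - 1)
    (hV : LLightLike (Submodule.span ℝ (Set.range fun i => p i - p o))) :
    ∃ x, IsRegularValue (LorDSM p) (LorDSM p x) ∧
      IsPreconnected (LorDSM p ⁻¹' {LorDSM p x}) := by
  obtain ⟨hT, hS⟩ := hV
  set V := Submodule.span ℝ (Set.range fun i => p i - p o)
  simp only [LTimeLike, LSpaceLike] at hT hS
  push Not at hT hS
  obtain ⟨u, huV, hu0, hu⟩ := hS
  have huu : lorIP u u = 0 := le_antisymm hu (hT u huV)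
  have hperp : ∀ w ∈ V, lorIP w u = 0 := by
    intro w hw
    by_contra hne
    have h := hT _ (add_mem hw (V.smul_mem (-(lorIP w w + 1) / (2 * lorIP w u)) huV))
    simp only [lorIP_add_left, lorIP_add_right, lorIP_smul_left, lorIP_smul_right, huu,
      lorIP_comm u w] at h
    have h2 : -(lorIP w w + 1) / (2 * lorIP w u) * lorIP w u = -(lorIP w w + 1) / 2 := by
      field_simp
    linarith
  have huperp : u ∈ (lorForm n).orthogonal V := hperp
  obtain ⟨z, hz⟩ := exists_lorIP_eq_eucIP u
  have hzu : lorIP z u ≠ 0 := by rw [hz]; exact (eucIP_self_pos hu0).ne'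
  refine ⟨p o + z, fun x hx => ?_, ?_⟩
  · rw [surjective_fderiv_lorDSM_iff_notMem hgen]
    intro hxV
    rw [lorDSM_eq_iff o] at hx
    have h1 : lorIP u (x - (p o + z)) = 0 := hx.1 u huV
    have h2 := hperp _ hxV
    apply hzu
    rw [lorIP_comm] at h1
    simp only [lorIP_sub_left, lorIP_add_left] at h1 h2
    linarith
  · let α : (Fin (n + 1) → ℝ) → ℝ := fun w =>
      (lorIP z z - lorIP (z + w) (z + w)) / (2 * lorIP z u)
    have himg : LorDSM p ⁻¹' {LorDSM p (p o + z)} =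
        (fun w => p o + z + w + α w • u) '' ((lorForm n).orthogonal V : Set _) := by
      ext x
      simp only [Set.mem_preimage, Set.mem_singleton_iff, Set.mem_image, SetLike.mem_coe]
      rw [lorDSM_eq_iff o, add_sub_cancel_left]
      constructor
      · rintro ⟨h1, h2⟩
        refine ⟨_, h1, ?_⟩
        have h3 : z + (x - (p o + z)) = x - p o := by abel
        simp [α, h3, h2]
      · rintro ⟨w, hw, rfl⟩
        constructor
        · convert add_mem hw (Submodule.smul_mem _ (α w) huperp) using 1
          abel
        · have hwu : lorIP w u = 0 := by rw [lorIP_comm]; exact hw u huV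
          have h3 : p o + z + w + α w • u - p o = z + w + α w • u := by abel
          have hα : α w * (2 * lorIP z u) = lorIP z z - lorIP (z + w) (z + w) :=
            div_mul_cancel₀ _ (by simpa using hzu)
          rw [h3, lorIP_add_left, lorIP_add_right (z + w), lorIP_add_right (α w • u)]
          simp only [lorIP_smul_left, lorIP_smul_right, huu, lorIP_comm u (z + w)]
          rw [lorIP_add_left z w u, hwu]
          linarith
    rw [himg]
    refine (Submodule.convex _).isPreconnected.image _ (Continuous.continuousOn ?_)
    simp only [α, lorIP]
    fun_prop

theorem isCompl_orthogonal_of_spaceLike {V : Submodule ℝ (Fin (n + 1) → ℝ)}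
    (hV : LSpaceLike V) : IsCompl V ((lorForm n).orthogonal V) := by
  rw [LinearMap.BilinForm.isCompl_orthogonal_iff_disjoint (lorForm_isSymm n).isRefl,
    Submodule.disjoint_def]
  intro v hv hv'
  by_contra h0
  exact (hV v hv h0).ne' (hv' v hv)

theorem lorIP_smul_add_smul_self {f₁ f₂ : Fin (n + 1) → ℝ} (h₁ : lorIP f₁ f₁ = 1)
    (h₂ : lorIP f₂ f₂ = -1) (h₁₂ : lorIP f₁ f₂ = 0) (s t : ℝ) :
    lorIP (s • f₁ + t • f₂) (s • f₁ + t • f₂) = s ^ 2 - t ^ 2 := by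
  simp only [lorIP_add_left, lorIP_add_right, lorIP_smul_left, lorIP_smul_right, h₁, h₂, h₁₂,
    lorIP_comm f₂ f₁]
  ring

theorem linearIndependent_pair_of_lorIP {f₁ f₂ : Fin (n + 1) → ℝ} (h₁ : lorIP f₁ f₁ = 1)
    (h₂ : lorIP f₂ f₂ = -1) (h₁₂ : lorIP f₁ f₂ = 0) : LinearIndependent ℝ ![f₁, f₂] := by
  rw [LinearIndependent.pair_iff]
  intro s t hst
  have hs : lorIP f₁ (s • f₁ + t • f₂) = s := by
    rw [lorIP_add_right, lorIP_smul_right, lorIP_smul_right, h₁, h₁₂]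
    ring
  have ht : lorIP f₂ (s • f₁ + t • f₂) = -t := by
    rw [lorIP_add_right, lorIP_smul_right, lorIP_smul_right, h₂, lorIP_comm f₂ f₁, h₁₂]
    ring
  rw [hst] at hs ht
  simp only [lorIP, Pi.zero_apply, mul_zero, Finset.sum_const_zero, sub_zero] at hs ht
  exact ⟨hs.symm, by linarith⟩

/-- The orthogonal complement of a space-like subspace of codimension two is a Lorentzian plane. -/
theorem exists_orthonormal_frame_orthogonal {V : Submodule ℝ (Fin (n + 1) → ℝ)}
    (hV : LSpaceLike V) (hdim : Module.finrank ℝ V + 1 = n) :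
    ∃ f₁ f₂, lorIP f₁ f₁ = 1 ∧ lorIP f₂ f₂ = -1 ∧ lorIP f₁ f₂ = 0 ∧
      (lorForm n).orthogonal V = Submodule.span ℝ {f₁, f₂} := by
  have hfr : Module.finrank ℝ ((lorForm n).orthogonal V) = 2 := by
    rw [LinearMap.BilinForm.finrank_orthogonal (lorForm_nondegenerate n), Module.finrank_fin_fun]
    omega
  obtain ⟨v, hv, w, hw, hvw⟩ := Submodule.mem_sup.1
    ((isCompl_orthogonal_of_spaceLike hV).sup_eq_top.symm ▸ Submodule.mem_top :
      (Pi.single 0 1 : Fin (n + 1) → ℝ) ∈ V ⊔ (lorForm n).orthogonal V)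
  have hww : lorIP w w < 0 := by
    have h1 : lorIP (Pi.single 0 1 : Fin (n + 1) → ℝ) (Pi.single 0 1) = -1 := by
      simp [lorIP, Pi.single_apply]
      norm_num
    have h2 : lorIP v w = 0 := hw v hv
    have h3 : 0 ≤ lorIP v v := by
      by_cases h0 : v = 0
      · simp [h0, lorIP]
      · exact (hV v hv h0).le
    rw [← hvw] at h1
    simp only [lorIP_add_left, lorIP_add_right, lorIP_comm w v, h2] at h1
    linarith
  obtain ⟨g, hg, hgw⟩ : ∃ g ∈ (lorForm n).orthogonal V, g ∉ Submodule.span ℝ {w} := by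
    by_contra! hle
    have h1 := Submodule.finrank_mono (show (lorForm n).orthogonal V ≤ _ from hle)
    have h2 := finrank_span_le_card (R := ℝ) ({w} : Set (Fin (n + 1) → ℝ))
    simp at h2
    omega
  let k := g - (lorIP w g / lorIP w w) • w
  have hkW : k ∈ (lorForm n).orthogonal V := sub_mem hg (Submodule.smul_mem _ _ hw)
  have hk0 : k ≠ 0 := fun h =>
    hgw (sub_eq_zero.1 h ▸ Submodule.smul_mem _ _ (Submodule.mem_span_singleton_self w))
  have hwk : lorIP w k = 0 := by
    rw [lorIP_sub_right, lorIP_smul_right, div_mul_cancel₀ _ hww.ne, sub_self]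
  have hkk : 0 < lorIP k k := lorIP_self_pos_of_orthogonal hww hwk hk0
  have hnk := Real.mul_self_sqrt hkk.le
  have hnw := Real.mul_self_sqrt (neg_pos.2 hww).le
  have hnk0 := (Real.sqrt_pos.2 hkk).ne'
  have hnw0 := (Real.sqrt_pos.2 (neg_pos.2 hww)).ne'
  have h₁ : lorIP ((√(lorIP k k))⁻¹ • k) ((√(lorIP k k))⁻¹ • k) = 1 := by
    rw [lorIP_smul_left, lorIP_smul_right]
    field_simp
    nlinarith
  have h₂ : lorIP ((√(-lorIP w w))⁻¹ • w) ((√(-lorIP w w))⁻¹ • w) = -1 := by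
    rw [lorIP_smul_left, lorIP_smul_right]
    field_simp
    nlinarith
  have h₁₂ : lorIP ((√(lorIP k k))⁻¹ • k) ((√(-lorIP w w))⁻¹ • w) = 0 := by
    rw [lorIP_smul_left, lorIP_smul_right, lorIP_comm k w, hwk]
    simp
  refine ⟨_, _, h₁, h₂, h₁₂, (Submodule.eq_of_le_of_finrank_eq ?_ ?_).symm⟩
  · rw [Submodule.span_le, Set.insert_subset_iff, Set.singleton_subset_iff]
    exact ⟨Submodule.smul_mem _ _ hkW, Submodule.smul_mem _ _ hw⟩
  · have := finrank_span_eq_card (linearIndependent_pair_of_lorIP h₁ h₂ h₁₂)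
    rw [Matrix.range_cons_cons_empty] at this
    rw [hfr, this, Fintype.card_fin]

/-- For a space-like recognition subspace, a linear automorphism carrying an orthonormal frame of
its orthogonal complement to a Euclidean one straightens all non-singular fibers. -/
theorem exists_linearEquiv_fiber_hyperbola (hmn : m = n)
    (hgen : Module.finrank ℝ (Submodule.span ℝ (Set.range fun i => p i - p o)) = m - 1)
    (hV : LSpaceLike (Submodule.span ℝ (Set.range fun i => p i - p o))) :
    ∃ e : (Fin (n + 1) → ℝ) ≃ₗ[ℝ] (Fin (n + 1) → ℝ), ∀ x,
      IsRegularValue (LorDSM p) (LorDSM p x) →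
        IsEquilateralHyperbola (e '' (LorDSM p ⁻¹' {LorDSM p x})) := by
  have hm : 0 < m := o.pos
  set V := Submodule.span ℝ (Set.range fun i => p i - p o)
  obtain ⟨f₁, f₂, h₁, h₂, h₁₂, hspan⟩ := exists_orthonormal_frame_orthogonal hV (by omega)
  let i₀ : Fin (n + 1) := ⟨0, by omega⟩
  let i₁ : Fin (n + 1) := ⟨1, by omega⟩
  have hne : i₁ ≠ i₀ := by simp [i₀, i₁]
  let E₁ : Fin (n + 1) → ℝ := Pi.single i₁ 1
  let E₂ : Fin (n + 1) → ℝ := Pi.single i₀ 1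
  have hE₁ : eucIP E₁ E₁ = 1 := by simp [eucIP_single_one_left, E₁]
  have hE₂ : eucIP E₂ E₂ = 1 := by simp [eucIP_single_one_left, E₂]
  have hE₁₂ : eucIP E₁ E₂ = 0 := by simp [eucIP_single_one_left, E₁, E₂, hne]
  have hE₂₁ : eucIP E₂ E₁ = 0 := by simp [eucIP_single_one_left, E₁, E₂, hne.symm]
  have hE : LinearIndependent ℝ ![E₁, E₂] := by
    rw [LinearIndependent.pair_iff]
    intro s t hst
    have hs := congrFun hst i₁
    have ht := congrFun hst i₀
    simp [E₁, E₂, hne, hne.symm] at hs ht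
    exact ⟨hs, ht⟩
  obtain ⟨e, he⟩ :=
    exists_linearEquiv_apply_eq (linearIndependent_pair_of_lorIP h₁ h₂ h₁₂) hE
  have he₁ : e f₁ = E₁ := he 0
  have he₂ : e f₂ = E₂ := he 1
  refine ⟨e, fun x hreg => ?_⟩
  obtain ⟨v, hv, w, hw, hvw⟩ := Submodule.mem_sup.1
    ((isCompl_orthogonal_of_spaceLike hV).sup_eq_top.symm ▸ Submodule.mem_top :
      x - p o ∈ V ⊔ (lorForm n).orthogonal V)
  have hx : x = p o + v + w := by
    rw [add_assoc, hvw]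
    abel
  have hself : ∀ w' ∈ (lorForm n).orthogonal V,
      lorIP (v + w') (v + w') = lorIP v v + lorIP w' w' := by
    intro w' hw'
    have h : lorIP v w' = 0 := hw' v hv
    simp only [lorIP_add_left, lorIP_add_right, lorIP_comm w' v, h]
    ring
  have hfib : ∀ x', LorDSM p x' = LorDSM p x ↔
      ∃ s t : ℝ, s ^ 2 - t ^ 2 = lorIP w w ∧ x' = p o + v + (s • f₁ + t • f₂) := by
    intro x'
    rw [lorDSM_eq_iff o, ← hvw, hself w hw]
    constructor
    · rintro ⟨h3, h4⟩
      have h5 := add_mem h3 hw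
      obtain ⟨s, t, hst⟩ := Submodule.mem_span_pair.1 (hspan ▸ h5)
      have hx' : x' = p o + v + (s • f₁ + t • f₂) := by
        rw [hst, hx]
        abel
      refine ⟨s, t, ?_, hx'⟩
      have h6 : x' - p o = v + (s • f₁ + t • f₂) := by rw [hx']; abel
      rw [h6, hself _ (hst ▸ h5), lorIP_smul_add_smul_self h₁ h₂ h₁₂] at h4
      linarith
    · rintro ⟨s, t, hst, rfl⟩
      have h5 : s • f₁ + t • f₂ ∈ (lorForm n).orthogonal V :=
        hspan ▸ Submodule.mem_span_pair.2 ⟨s, t, rfl⟩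
      have h6 : p o + v + (s • f₁ + t • f₂) - p o = v + (s • f₁ + t • f₂) := by abel
      refine ⟨?_, ?_⟩
      · convert sub_mem h5 hw using 1
        rw [hx]
        abel
      · rw [h6, hself _ h5, lorIP_smul_add_smul_self h₁ h₂ h₁₂, hst]
  have himg : e '' (LorDSM p ⁻¹' {LorDSM p x}) =
      {y | ∃ s t : ℝ, s ^ 2 - t ^ 2 = lorIP w w ∧ y = e (p o + v) + s • E₁ + t • E₂} := by
    ext y
    simp only [Set.mem_image, Set.mem_preimage, Set.mem_singleton_iff, hfib, Set.mem_ofPred_eq]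
    constructor
    · rintro ⟨_, ⟨s, t, hst, rfl⟩, rfl⟩
      exact ⟨s, t, hst, by simp only [map_add, map_smul, he₁, he₂]; abel⟩
    · rintro ⟨s, t, hst, rfl⟩
      exact ⟨_, ⟨s, t, hst, rfl⟩, by simp only [map_add, map_smul, he₁, he₂]; abel⟩
  have hc : lorIP w w ≠ 0 := by
    intro h0
    have h7 := hreg (p o + v) ((hfib _).2 ⟨0, 0, by simp [h0], by simp⟩)
    rw [surjective_fderiv_lorDSM_iff_notMem hgen, add_sub_cancel_left] at h7
    exact h7 hv
  rw [himg]
  rcases hc.lt_or_gt with hneg | hpos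
  · refine ⟨e (p o + v), E₂, E₁, √(-lorIP w w), (Real.sqrt_pos.2 (neg_pos.2 hneg)).ne', hE₂, hE₁,
      hE₂₁, ?_⟩
    rw [Real.sq_sqrt (neg_pos.2 hneg).le]
    ext y
    constructor
    · rintro ⟨s, t, hst, rfl⟩
      exact ⟨t, s, by linarith, by abel⟩
    · rintro ⟨s, t, hst, rfl⟩
      exact ⟨t, s, by linarith, by abel⟩
  · refine ⟨e (p o + v), E₁, E₂, √(lorIP w w), (Real.sqrt_pos.2 hpos).ne', hE₁, hE₂, hE₁₂, ?_⟩
    rw [Real.sq_sqrt hpos.le]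

end Fibers

theorem corollary1_2 (n : ℕ) (hn : 2 ≤ n) (p : Fin n → Fin (n + 1) → ℝ)
    (hgen : Module.finrank ℝ
        (Submodule.span ℝ (Set.range fun i => p i - p ⟨0, by omega⟩)) = n - 1) :
    (∃ h : (Fin (n + 1) → ℝ) ≃ (Fin (n + 1) → ℝ),
        ContDiff ℝ (⊤ : ℕ∞) ⇑h ∧ ContDiff ℝ (⊤ : ℕ∞) ⇑h.symm ∧
        ∀ y : Fin n → ℝ, IsRegularValue (LorDSM p) y → (LorDSM p ⁻¹' {y}).Nonempty →
          IsEquilateralHyperbola (⇑h '' (LorDSM p ⁻¹' {y})))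
      ↔ LSpaceLike (Submodule.span ℝ (Set.range fun i => p i - p ⟨0, by omega⟩)) := by
  constructor
  · rintro ⟨h, hh, -, hyp⟩
    by_contra hS
    by_cases hT : LTimeLike (Submodule.span ℝ (Set.range fun i => p i - p ⟨0, by omega⟩))
    · obtain ⟨x, hreg, hcpt⟩ := exists_isCompact_fiber_of_timeLike le_rfl hgen hT
      exact (hyp _ hreg ⟨x, rfl⟩).not_isCompact (hcpt.image hh.continuous)
    · obtain ⟨x, hreg, hconn⟩ := exists_isPreconnected_fiber_of_lightLike hgen ⟨hT, hS⟩
      exact (hyp _ hreg ⟨x, rfl⟩).not_isPreconnected (hconn.image _ hh.continuous.continuousOn)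
  · intro hS
    obtain ⟨e, he⟩ := exists_linearEquiv_fiber_hyperbola rfl hgen hS
    refine ⟨e.toEquiv, e.toContinuousLinearEquiv.contDiff,
      e.toContinuousLinearEquiv.symm.contDiff, ?_⟩
    rintro _ hreg ⟨x, rfl⟩
    exact he x hreg
end
end

section
/- Let k, n be positive integers with k ≤ n, and let p₀,…,p_k ∈ ℝ^{n+1} be (k+1) points in general position. Then the Euclidean distance-squared mapping D_{(p₀,…,p_k)} : ℝ^{n+1} → ℝ^{k+1} is A-equivalent to the normal form of definite fold mapping Φ_k. -/
open scoped BigOperators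

noncomputable section

open scoped ContDiff

/-- A sum over `Fin (n + 1)`, split at the index `0`, the block `1, …, k` and the rest. -/
lemma sum_fin_eq_zero_add_tail_add_block {k n : ℕ} (hkn : k ≤ n) (f : Fin (n + 1) → ℝ) :
    ∑ j, f j = f 0 + (∑ j : Fin (n + 1), if k + 1 ≤ (j : ℕ) then f j else 0)
      + ∑ i : Fin k, f ⟨(i : ℕ) + 1, by omega⟩ := by
  have hblock : ∑ i : Fin k, f ⟨(i : ℕ) + 1, by omega⟩
      = ∑ j : Fin (n + 1), if 1 ≤ (j : ℕ) ∧ (j : ℕ) ≤ k then f j else 0 := by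
    rw [← Finset.sum_filter]
    refine Finset.sum_bij (fun i _ => ⟨(i : ℕ) + 1, by omega⟩) ?_ ?_ ?_ ?_
    · intro i _
      simp
    · intro i _ j _ hij
      simpa [Fin.ext_iff] using hij
    · intro j hj
      simp only [Finset.mem_filter, Finset.mem_univ, true_and] at hj
      exact ⟨⟨(j : ℕ) - 1, by omega⟩, Finset.mem_univ _, by ext; simp; omega⟩
    · intro i _
      rfl
  have hzero : f 0 = ∑ j : Fin (n + 1), if j = 0 then f j else 0 := by
    rw [Finset.sum_ite_eq' Finset.univ 0 f, if_pos (Finset.mem_univ _)]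
  rw [hblock, hzero, ← Finset.sum_add_distrib, ← Finset.sum_add_distrib]
  refine Finset.sum_congr rfl fun j _ => ?_
  have hj : j = 0 ↔ (j : ℕ) = 0 := Fin.ext_iff
  rw [if_congr hj rfl rfl]
  split_ifs <;> first | omega | simp

lemma eucIP_eq_inner {m : ℕ} (x y : Fin m → ℝ) :
    eucIP x y = inner ℝ (WithLp.toLp 2 x) (WithLp.toLp 2 y) := by
  simp [eucIP, PiLp.inner_apply, mul_comm]

/-- For a `k`-dimensional subspace `V` there is a linear isometry carrying the span of the
coordinate vectors with indices `1, …, k` onto `V`. -/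
lemma exists_isometry_mem_iff {k n : ℕ} (hkn : k ≤ n)
    (V : Submodule ℝ (Fin (n + 1) → ℝ)) (hV : Module.finrank ℝ V = k) :
    ∃ L : (Fin (n + 1) → ℝ) ≃ₗ[ℝ] (Fin (n + 1) → ℝ),
      (∀ x y, eucIP (L x) (L y) = eucIP x y) ∧
      ∀ x, L x ∈ V ↔ ∀ j : Fin (n + 1), (j = 0 ∨ k + 1 ≤ (j : ℕ)) → x j = 0 := by
  set e := (WithLp.linearEquiv 2 ℝ (Fin (n + 1) → ℝ)).symm
  set W : Submodule ℝ (EuclideanSpace ℝ (Fin (n + 1))) := V.map e.toLinearMap with hW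
  have hWk : Module.finrank ℝ W = k := by rw [hW, LinearEquiv.finrank_map_eq, hV]
  set c : OrthonormalBasis (Fin k) ℝ W := (stdOrthonormalBasis ℝ W).reindex (finCongr hWk)
  set s : Set (Fin (n + 1)) := {j | 1 ≤ (j : ℕ) ∧ (j : ℕ) ≤ k} with hs
  set v : Fin (n + 1) → EuclideanSpace ℝ (Fin (n + 1)) := fun j =>
    if h : 1 ≤ (j : ℕ) ∧ (j : ℕ) ≤ k then (c ⟨(j : ℕ) - 1, by omega⟩ : W) else 0 with hv
  have hvs : Orthonormal ℝ (s.domRestrict v) := by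
    have hc : Orthonormal ℝ (fun i => ((c i : W) : EuclideanSpace ℝ (Fin (n + 1)))) :=
      c.orthonormal.comp_linearIsometry W.subtypeₗᵢ
    have hinj : Function.Injective fun j : s => (⟨((j : Fin (n + 1)) : ℕ) - 1, by
        have := j.2; simp only [hs, Set.mem_ofPred_eq] at this; omega⟩ : Fin k) := by
      rintro ⟨i, hi⟩ ⟨j, hj⟩ hij
      simp only [hs, Set.mem_ofPred_eq, Fin.mk.injEq] at hi hj hij
      ext
      simp only
      omega
    convert hc.comp _ hinj using 1
    ext1 ⟨j, hj⟩
    exact dif_pos hj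
  obtain ⟨b, hb⟩ := hvs.exists_orthonormalBasis_extension_of_card_eq (by simp)
  have hbc : ∀ i : Fin k, b ⟨(i : ℕ) + 1, by omega⟩ = (c i : W) := by
    intro i
    rw [hb _ (by simp [hs])]
    simp [hv]
  have hmem : ∀ j : Fin (n + 1), (1 ≤ (j : ℕ) ∧ (j : ℕ) ≤ k) → b j ∈ W := by
    intro j hj
    rw [hb j hj]
    simp only [hv, dif_pos hj]
    exact (c _).2
  have horth : ∀ j : Fin (n + 1), (j = 0 ∨ k + 1 ≤ (j : ℕ)) → ∀ w ∈ W, inner ℝ (b j) w = 0 := by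
    intro j hj w hw
    have hsum := congrArg (Subtype.val) (c.sum_repr ⟨w, hw⟩)
    simp only [Submodule.coe_sum, Submodule.coe_smul] at hsum
    rw [← hsum, inner_sum]
    refine Finset.sum_eq_zero fun i _ => ?_
    rw [← hbc, inner_smul_right, b.inner_eq_zero, mul_zero]
    rintro rfl
    simp only [Fin.ext_iff, Fin.val_zero] at hj
    omega
  refine ⟨e ≪≫ₗ b.repr.symm.toLinearEquiv ≪≫ₗ e.symm, fun x y => ?_, fun x => ?_⟩
  · rw [eucIP_eq_inner, eucIP_eq_inner]
    exact b.repr.symm.inner_map_map _ _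
  · have hLx : (e ≪≫ₗ b.repr.symm.toLinearEquiv ≪≫ₗ e.symm) x ∈ V ↔ b.repr.symm (e x) ∈ W := by
      rw [hW, Submodule.mem_map_equiv]
      rfl
    rw [hLx]
    constructor
    · intro h j hj
      have := horth j hj _ h
      rw [← b.repr_apply_apply, LinearIsometryEquiv.apply_symm_apply] at this
      exact this
    · intro h
      rw [← b.sum_repr_symm]
      refine W.sum_mem fun j _ => ?_
      by_cases hj : j = 0 ∨ k + 1 ≤ (j : ℕ)
      · have : (e x) j = 0 := h j hj
        rw [this, zero_smul]
        exact W.zero_mem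
      · refine W.smul_mem _ (hmem j ?_)
        rw [Fin.ext_iff, Fin.val_zero] at hj
        omega

lemma eucIP_sub_self {m : ℕ} (x y : Fin m → ℝ) :
    eucIP (x - y) (x - y) = eucIP x x - 2 * eucIP y x + eucIP y y := by
  simp only [eucIP, Finset.mul_sum, ← Finset.sum_sub_distrib, ← Finset.sum_add_distrib]
  refine Finset.sum_congr rfl fun i _ => ?_
  simp only [Pi.sub_apply]
  ring

/-- The polynomial diffeomorphism of the target taking the squared distances `Y` to the fold
normal form: `S` recovers the block coordinates from the differences `Y 0 - Y i.succ`, up to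
the constants `a`. -/
def foldTargetEquiv {k : ℕ} (S : (Fin k → ℝ) ≃ₗ[ℝ] (Fin k → ℝ)) (a : Fin k → ℝ) :
    (Fin (k + 1) → ℝ) ≃ (Fin (k + 1) → ℝ) where
  toFun Y := Fin.snoc (S.symm fun i => (Y 0 - Y i.succ + a i) / 2)
    (Y 0 - eucIP (S.symm fun i => (Y 0 - Y i.succ + a i) / 2)
      (S.symm fun i => (Y 0 - Y i.succ + a i) / 2)) (α := fun _ => ℝ)
  invFun z := Fin.cons (z (Fin.last k) + eucIP (Fin.init z) (Fin.init z))
    (fun i => z (Fin.last k) + eucIP (Fin.init z) (Fin.init z) + a i - 2 * S (Fin.init z) i)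
    (α := fun _ => ℝ)
  left_inv Y := by
    funext i
    refine Fin.cases ?_ (fun i => ?_) i
    · simp
    · simp
      ring
  right_inv z := by
    have hS : ∀ t, (S.symm fun i => (t - (t + a i - 2 * S (Fin.init z) i) + a i) / 2)
        = Fin.init z := by
      intro t
      rw [LinearEquiv.symm_apply_eq]
      funext i
      ring
    funext i
    refine Fin.lastCases ?_ (fun i => ?_) i
    · simp [hS]
    · simp [hS, Fin.init]

lemma contDiff_eucIP_self {m : ℕ} : ContDiff ℝ ∞ fun x : Fin m → ℝ => eucIP x x := by
  unfold eucIP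
  fun_prop

lemma contDiff_linearEquiv {m : ℕ} (L : (Fin m → ℝ) ≃ₗ[ℝ] (Fin m → ℝ)) : ContDiff ℝ ∞ L :=
  L.toContinuousLinearEquiv.contDiff

lemma contDiff_foldTargetEquiv {k : ℕ} (S : (Fin k → ℝ) ≃ₗ[ℝ] (Fin k → ℝ)) (a : Fin k → ℝ) :
    ContDiff ℝ ∞ (foldTargetEquiv S a) := by
  have hw : ContDiff ℝ ∞ fun Y : Fin (k + 1) → ℝ =>
      S.symm fun i => (Y 0 - Y i.succ + a i) / 2 :=
    (contDiff_linearEquiv S.symm).comp (by fun_prop)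
  rw [contDiff_pi]
  intro i
  refine Fin.lastCases ?_ (fun i => ?_) i
  · simp only [foldTargetEquiv, Equiv.coe_fn_mk, Fin.snoc_last]
    exact (contDiff_apply ℝ ℝ 0).sub (contDiff_eucIP_self.comp hw)
  · simp only [foldTargetEquiv, Equiv.coe_fn_mk, Fin.snoc_castSucc]
    exact contDiff_pi.1 hw i

lemma contDiff_foldTargetEquiv_symm {k : ℕ} (S : (Fin k → ℝ) ≃ₗ[ℝ] (Fin k → ℝ))
    (a : Fin k → ℝ) : ContDiff ℝ ∞ (foldTargetEquiv S a).symm := by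
  have hinit : ContDiff ℝ ∞ fun z : Fin (k + 1) → ℝ => (Fin.init z : Fin k → ℝ) := by
    unfold Fin.init
    fun_prop
  have hzero : ContDiff ℝ ∞ fun z : Fin (k + 1) → ℝ =>
      z (Fin.last k) + eucIP (Fin.init z : Fin k → ℝ) (Fin.init z) :=
    (contDiff_apply ℝ ℝ _).add (contDiff_eucIP_self.comp hinit)
  have hS := contDiff_pi.1 ((contDiff_linearEquiv S).comp hinit)
  rw [contDiff_pi]
  intro i
  refine Fin.cases ?_ (fun i => ?_) i
  · simpa [foldTargetEquiv] using hzero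
  · simp only [foldTargetEquiv, Equiv.coe_fn_symm_mk, Fin.cons_succ]
    exact (hzero.add contDiff_const).sub (contDiff_const.mul (hS i))

theorem prop1_1 (k n : ℕ) (hk : 1 ≤ k) (hkn : k ≤ n)
    (p : Fin (k + 1) → Fin (n + 1) → ℝ)
    (hgen : Module.finrank ℝ (recSub p) = k) :
    AEquiv (EucDSM p)
        (fun (x : Fin (n + 1) → ℝ) (i : Fin (k + 1)) =>
          if h : (i : ℕ) < k then x ⟨(i : ℕ) + 1, by omega⟩
          else x 0 ^ 2 + ∑ j : Fin (n + 1), if k + 1 ≤ (j : ℕ) then x j ^ 2 else 0) := by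
  obtain ⟨L, hLip, hLV⟩ := exists_isometry_mem_iff hkn (recSub p) hgen
  set w : Fin (k + 1) → Fin (n + 1) → ℝ := fun i => L.symm (p i - p 0) with hw
  have hLw : ∀ i, L (w i) = p i - p 0 := fun i => L.apply_symm_apply _
  have hw0 : ∀ i (j : Fin (n + 1)), (j = 0 ∨ k + 1 ≤ (j : ℕ)) → w i j = 0 := by
    intro i
    rw [← hLV, hLw]
    exact Submodule.subset_span ⟨i, rfl⟩
  have hwx : ∀ i x, eucIP (w i) x =
      ∑ j : Fin k, w i ⟨(j : ℕ) + 1, by omega⟩ * x ⟨(j : ℕ) + 1, by omega⟩ := by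
    intro i x
    rw [eucIP, sum_fin_eq_zero_add_tail_add_block hkn, hw0 i 0 (Or.inl rfl),
      Finset.sum_eq_zero (s := Finset.univ)
        (f := fun j : Fin (n + 1) => if k + 1 ≤ (j : ℕ) then w i j * x j else 0)]
    · simp
    · intro j _
      split_ifs with hj
      · rw [hw0 i j (Or.inr hj), zero_mul]
      · rfl
  set A : Matrix (Fin k) (Fin k) ℝ := fun i j => w i.succ ⟨(j : ℕ) + 1, by omega⟩
  have hinj : Function.Injective (Matrix.toLin' A) := by
    rw [← LinearMap.ker_eq_bot, LinearMap.ker_eq_bot']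
    intro c hc
    set x : Fin (n + 1) → ℝ := fun j =>
      if h : 1 ≤ (j : ℕ) ∧ (j : ℕ) ≤ k then c ⟨(j : ℕ) - 1, by omega⟩ else 0 with hx
    have hxc : ∀ j : Fin k, x ⟨(j : ℕ) + 1, by omega⟩ = c j := by
      intro j
      simp [hx]
    have hLx : L x ∈ recSub p := by
      rw [hLV]
      rintro j (rfl | hj)
      · simp [hx]
      · exact dif_neg (by omega)
    have horth : ∀ v ∈ recSub p, eucIP v (L x) = 0 := by
      intro v hv
      induction hv using Submodule.span_induction with
      | mem v hv =>
        obtain ⟨i, rfl⟩ := hv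
        simp only
        rw [← hLw, hLip]
        refine Fin.cases ?_ (fun i => ?_) i
        · simp [hw, eucIP]
        · rw [hwx]
          simp only [hxc]
          exact congrFun hc i
      | zero => simp [eucIP]
      | add u v _ _ hu hv =>
        simp only [eucIP] at hu hv ⊢
        simp [add_mul, Finset.sum_add_distrib, hu, hv]
      | smul r v _ hv =>
        simp only [eucIP] at hv ⊢
        simp [mul_assoc, ← Finset.mul_sum, hv]
    have hxx : eucIP x x = 0 := by rw [← hLip]; exact horth _ hLx
    funext i
    rw [← hxc]
    exact mul_self_eq_zero.1
      ((Finset.sum_eq_zero_iff_of_nonneg fun j _ => mul_self_nonneg (x j)).1 hxx _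
        (Finset.mem_univ _))
  set S := LinearEquiv.ofInjectiveEndo _ hinj
  have hS : ∀ c i, S c i = ∑ j : Fin k, w (Fin.succ i) ⟨(j : ℕ) + 1, by omega⟩ * c j :=
    fun _ _ => rfl
  refine ⟨L.toEquiv.trans (Equiv.addRight (p 0)),
    foldTargetEquiv S fun i => eucIP (w i.succ) (w i.succ),
    (contDiff_linearEquiv L).add contDiff_const,
    (contDiff_linearEquiv L.symm).comp (contDiff_id.add contDiff_const),
    contDiff_foldTargetEquiv _ _, contDiff_foldTargetEquiv_symm _ _, ?_⟩
  funext x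
  rw [Function.comp_apply, ← Equiv.symm_apply_eq]
  have hf : ∀ i, EucDSM p (L x + p 0) i =
      eucIP x x - 2 * eucIP (w i) x + eucIP (w i) (w i) := by
    intro i
    rw [← eucIP_sub_self, ← hLip, map_sub, hLw, EucDSM]
    congr 1 <;> abel
  have hxx := sum_fin_eq_zero_add_tail_add_block hkn fun j => x j * x j
  have hw00 : w 0 = 0 := by simp [hw]
  funext i
  change _ = EucDSM p (L x + p 0) i
  rw [hf]
  refine Fin.cases ?_ (fun i => ?_) i
  · simp [foldTargetEquiv, hw00, eucIP, Fin.init, hxx, pow_two]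
  · simp only [foldTargetEquiv, Equiv.coe_fn_symm_mk, Fin.cons_succ, hS, hwx _ x]
    simp [eucIP, Fin.init, hxx, pow_two]
    ring
end
end

section
/- Let k, n be positive integers with n < k, and let p₀,…,p_k ∈ ℝ^{n+1} be (k+1) points such that the (n+2) points p₀,…,p_{n+1} are in general position. Then the Euclidean distance-squared mapping D_{(p₀,…,p_k)} : ℝ^{n+1} → ℝ^{k+1} is A-equivalent to the inclusion (x₀,…,xₙ) ↦ (x₀,…,xₙ, 0,…,0). -/
open scoped BigOperators

noncomputable section

/-- If a linear map `q` is a left inverse of both the smooth map `g` and a smooth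
reparametrization `f ∘ h` of `f`, then `f` and `g` are `𝒜`-equivalent: the target diffeomorphism
is the shear `y ↦ y + (g (q y) - f (h (q y)))` along the fibres of `q`. -/
theorem AEquiv.of_common_leftInverse {a b : ℕ} {f g : (Fin a → ℝ) → (Fin b → ℝ)}
    (hf : ContDiff ℝ (⊤ : ℕ∞) f) (hg : ContDiff ℝ (⊤ : ℕ∞) g)
    (h : (Fin a → ℝ) ≃ (Fin a → ℝ)) (hh : ContDiff ℝ (⊤ : ℕ∞) h)
    (hh' : ContDiff ℝ (⊤ : ℕ∞) h.symm) (q : (Fin b → ℝ) →L[ℝ] (Fin a → ℝ))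
    (hqf : ∀ u, q (f (h u)) = u) (hqg : ∀ u, q (g u) = u) : AEquiv f g := by
  have hq := q.contDiff (n := (⊤ : ℕ∞))
  have hF := hf.comp (hh.comp hq)
  have hG := hg.comp hq
  refine ⟨h,
    { toFun := fun y => y + (g (q y) - f (h (q y)))
      invFun := fun y => y - (g (q y) - f (h (q y)))
      left_inv := fun y => ?_
      right_inv := fun y => ?_ }, hh, hh', contDiff_id.add (hG.sub hF),
    contDiff_id.sub (hG.sub hF), ?_⟩
  · simp [hqf, hqg]
  · simp [hqf, hqg]
  · funext u
    simp [hqf]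

theorem contDiff_EucDSM {n m : ℕ} (p : Fin m → Fin (n + 1) → ℝ) :
    ContDiff ℝ (⊤ : ℕ∞) (EucDSM p) := by
  unfold EucDSM eucIP
  simp only [Pi.sub_apply]
  fun_prop

theorem EucDSM_sub {n m : ℕ} (p : Fin m → Fin (n + 1) → ℝ) (x : Fin (n + 1) → ℝ) (i j : Fin m) :
    EucDSM p x i - EucDSM p x j =
      2 * ((p j - p i) ⬝ᵥ x) + (p i ⬝ᵥ p i - p j ⬝ᵥ p j) := by
  simp only [EucDSM, eucIP, dotProduct, Pi.sub_apply, ← Finset.sum_sub_distrib, Finset.mul_sum,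
    ← Finset.sum_add_distrib]
  exact Finset.sum_congr rfl fun _ _ => by ring

/-- Orthogonality to every vector of a full-dimensional span forces a vector to vanish. -/
theorem eq_zero_of_dotProduct_recSubUpTo {n k m : ℕ} {p : Fin (k + 1) → Fin (n + 1) → ℝ}
    (hgen : Module.finrank ℝ (recSubUpTo p m) = n + 1) {x : Fin (n + 1) → ℝ}
    (hx : ∀ i : Fin (k + 1), (i : ℕ) ≤ m → (p i - p 0) ⬝ᵥ x = 0) : x = 0 := by
  have htop : recSubUpTo p m = ⊤ := Submodule.eq_top_of_finrank_eq (by simpa using hgen)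
  have hmem : x ∈ recSubUpTo p m := htop ▸ Submodule.mem_top
  refine dotProduct_self_eq_zero.mp ?_
  have key : ∀ v ∈ recSubUpTo p m, v ⬝ᵥ x = 0 := by
    intro v hv
    induction hv using Submodule.span_induction with
    | mem v hv =>
      obtain ⟨i, hi, rfl⟩ := hv
      exact hx i hi
    | zero => exact zero_dotProduct x
    | add v w _ _ hv hw => rw [add_dotProduct, hv, hw, add_zero]
    | smul c v _ hv => rw [smul_dotProduct, hv, smul_zero]
  exact key x hmem

theorem prop1_2 (k n : ℕ) (hn : 1 ≤ n) (hnk : n < k)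
    (p : Fin (k + 1) → Fin (n + 1) → ℝ)
    (hgen : Module.finrank ℝ (recSubUpTo p (n + 1)) = n + 1) :
    AEquiv (EucDSM p)
        (fun (x : Fin (n + 1) → ℝ) (i : Fin (k + 1)) =>
          if h : (i : ℕ) < n + 1 then x ⟨(i : ℕ), h⟩ else 0) := by
  let ι : Fin (n + 1) → Fin (k + 1) := fun j => ⟨j, by omega⟩
  let l : Fin (k + 1) := ⟨n + 1, by omega⟩
  let q : (Fin (k + 1) → ℝ) →L[ℝ] (Fin (n + 1) → ℝ) :=
    ContinuousLinearMap.pi fun j =>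
      ContinuousLinearMap.proj (R := ℝ) (φ := fun _ => ℝ) (ι j) - ContinuousLinearMap.proj l
  let M : (Fin (n + 1) → ℝ) →ₗ[ℝ] (Fin (n + 1) → ℝ) :=
    (2 : ℝ) • Matrix.mulVecLin (Matrix.of fun j => p l - p (ι j))
  let c : Fin (n + 1) → ℝ := fun j => p (ι j) ⬝ᵥ p (ι j) - p l ⬝ᵥ p l
  have hM : ∀ x j, M x j = 2 * ((p l - p (ι j)) ⬝ᵥ x) := fun x j => rfl
  have hqf : ∀ x, q (EucDSM p x) = M x + c := fun x =>
    funext fun j => EucDSM_sub p x (ι j) l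
  have hinj : Function.Injective M := by
    refine (injective_iff_map_eq_zero M).mpr fun x hx => ?_
    have hl : ∀ i : Fin (k + 1), (i : ℕ) ≤ n + 1 → p i ⬝ᵥ x = p l ⬝ᵥ x := by
      intro i hi
      rcases hi.lt_or_eq with hi | hi
      · have := congrFun hx ⟨i, hi⟩
        rw [hM, sub_dotProduct] at this
        simp only [Pi.zero_apply, ι] at this
        linarith
      · rw [show i = l from Fin.ext hi]
    refine eq_zero_of_dotProduct_recSubUpTo hgen fun i hi => ?_
    rw [sub_dotProduct, hl i hi, hl 0 (Nat.zero_le _), sub_self]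
  let e : (Fin (n + 1) → ℝ) ≃L[ℝ] (Fin (n + 1) → ℝ) :=
    (LinearEquiv.ofInjectiveEndo M hinj).toContinuousLinearEquiv
  have he : ∀ x, e x = M x := fun x => rfl
  let h : (Fin (n + 1) → ℝ) ≃ (Fin (n + 1) → ℝ) :=
    (e.toEquiv.trans (Equiv.addRight c)).symm
  refine AEquiv.of_common_leftInverse (contDiff_EucDSM p) ?_ h
    (e.symm.contDiff.comp (contDiff_id.add contDiff_const))
    (e.contDiff.add contDiff_const) q (fun u => ?_) fun u => ?_
  · refine contDiff_pi.mpr fun i => ?_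
    split_ifs
    · exact contDiff_apply ℝ ℝ _
    · exact contDiff_const
  · rw [hqf, ← he]
    exact h.symm_apply_apply u
  · funext j
    simp [q, ι, l, j.is_le]
end
end

section
/- Let k, n be positive integers with n < k, and let p₀,…,p_k ∈ ℝ^{1,n} be (k+1) points such that the (n+2) points p₀,…,p_{n+1} are in general position. Then the Lorentzian distance-squared mapping L_{(p₀,…,p_k)} is always A-equivalent to the Euclidean distance-squared mapping D_{(p₀,…,p_k)}. -/
open scoped BigOperators

noncomputable section

/-- The reflection `x₀ ↦ 2c - x₀` of the first coordinate, as an equivalence. -/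
def timeReflection {n : ℕ} (c : ℝ) : (Fin (n + 1) → ℝ) ≃ (Fin (n + 1) → ℝ) where
  toFun x := Fin.cons (2 * c - x 0) (fun j : Fin n => x j.succ)
  invFun x := Fin.cons (2 * c - x 0) (fun j : Fin n => x j.succ)
  left_inv x := by
    ext j
    refine Fin.cases ?_ (fun j => ?_) j <;> simp
  right_inv x := by
    ext j
    refine Fin.cases ?_ (fun j => ?_) j <;> simp

theorem contDiff_timeReflection {n : ℕ} (c : ℝ) :
    ContDiff ℝ (⊤ : ℕ∞) (timeReflection (n := n) c) := by
  rw [contDiff_pi]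
  intro j
  refine Fin.cases ?_ (fun j => ?_) j
  · simp only [timeReflection, Equiv.coe_fn_mk, Fin.cons_zero]
    fun_prop
  · simp only [timeReflection, Equiv.coe_fn_mk, Fin.cons_succ]
    fun_prop

/-- The shear `y ↦ y + d + s(y + d) • (1, …, 1)`, for `s` invariant along `(1, …, 1)`. -/
def diagonalShear {m : ℕ} (d : Fin m → ℝ) (s : (Fin m → ℝ) → ℝ)
    (hs : ∀ y t, s (fun i => y i + t) = s y) : (Fin m → ℝ) ≃ (Fin m → ℝ) where
  toFun y := fun i => (y i + d i) + s (fun j => y j + d j)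
  invFun z := fun i => z i - s z - d i
  left_inv y := by
    ext i
    simp [hs (fun j => y j + d j)]
  right_inv z := by
    ext i
    have h : s (fun j => z j - s z) = s z := by simpa [sub_eq_add_neg] using hs z (-s z)
    simp [h]

/-- Replacing Lorentzian by Euclidean distance costs only the two time coordinates, once the
argument is reflected in the time coordinate of the base point. -/
theorem LorDSM_timeReflection {n k : ℕ} (p : Fin (k + 1) → Fin (n + 1) → ℝ)
    (x : Fin (n + 1) → ℝ) (i : Fin (k + 1)) :
    LorDSM p (timeReflection (p 0 0) x) i =
      EucDSM p x i - 2 * (x 0 - p 0 0) ^ 2 - 2 * (p i 0 - p 0 0) ^ 2 := by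
  simp only [LorDSM, EucDSM, lorIP, eucIP, timeReflection, Equiv.coe_fn_mk, Pi.sub_apply,
    Fin.sum_univ_succ, Fin.cons_zero, Fin.cons_succ]
  ring

theorem EucDSM_sub_EucDSM_zero {n k : ℕ} (p : Fin (k + 1) → Fin (n + 1) → ℝ)
    (x : Fin (n + 1) → ℝ) (i : Fin (k + 1)) :
    EucDSM p x i - EucDSM p x 0 - eucIP (p i - p 0) (p i - p 0) =
      -2 * eucIP (x - p 0) (p i - p 0) := by
  simp only [EucDSM, eucIP, Pi.sub_apply, Finset.mul_sum, ← Finset.sum_sub_distrib]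
  refine Finset.sum_congr rfl fun j _ => ?_
  ring

/-- If the points span, the time coordinate is recovered from differences of the components of
the Euclidean distance-squared mapping. -/
theorem exists_coeff_EucDSM_eq_time {n k : ℕ} (p : Fin (k + 1) → Fin (n + 1) → ℝ)
    (hp : recSub p = ⊤) :
    ∃ a : Fin (k + 1) → ℝ, ∀ x, ∑ i, a i *
      (EucDSM p x i - EucDSM p x 0 - eucIP (p i - p 0) (p i - p 0)) = x 0 - p 0 0 := by
  have hmem : (Pi.single 0 1 : Fin (n + 1) → ℝ) ∈ recSub p := hp ▸ Submodule.mem_top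
  obtain ⟨a, ha⟩ := Submodule.mem_span_range_iff_exists_fun ℝ |>.1 hmem
  refine ⟨fun i => -(1 / 2) * a i, fun x => ?_⟩
  calc ∑ i, -(1 / 2) * a i *
        (EucDSM p x i - EucDSM p x 0 - eucIP (p i - p 0) (p i - p 0))
      = ∑ i, ∑ j, (x j - p 0 j) * (a i * (p i j - p 0 j)) := by
        refine Finset.sum_congr rfl fun i _ => ?_
        rw [EucDSM_sub_EucDSM_zero, eucIP, Finset.mul_sum, Finset.mul_sum]
        refine Finset.sum_congr rfl fun j _ => ?_
        simp only [Pi.sub_apply]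
        ring
    _ = ∑ j, (x j - p 0 j) * (∑ i, a i • (p i - p 0)) j := by
        rw [Finset.sum_comm]
        simp [Finset.mul_sum]
    _ = x 0 - p 0 0 := by rw [ha]; simp [Pi.single_apply]

theorem recSubUpTo_le_recSub {n k : ℕ} (p : Fin (k + 1) → Fin (n + 1) → ℝ) (j : ℕ) :
    recSubUpTo p j ≤ recSub p := by
  refine Submodule.span_mono ?_
  rintro _ ⟨i, -, rfl⟩
  exact ⟨i, rfl⟩

theorem aEquiv_of_recSub_eq_top {n k : ℕ} (p : Fin (k + 1) → Fin (n + 1) → ℝ)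
    (hp : recSub p = ⊤) : AEquiv (LorDSM p) (EucDSM p) := by
  obtain ⟨a, ha⟩ := exists_coeff_EucDSM_eq_time p hp
  let s : (Fin (k + 1) → ℝ) → ℝ := fun y =>
    2 * (∑ i, a i * (y i - y 0 - eucIP (p i - p 0) (p i - p 0))) ^ 2
  have hs : ∀ y t, s (fun i => y i + t) = s y := fun y t => by simp [s]
  have hs' : ContDiff ℝ (⊤ : ℕ∞) s := by fun_prop
  let H := diagonalShear (fun i => 2 * (p i 0 - p 0 0) ^ 2) s hs
  refine ⟨timeReflection (p 0 0), H, contDiff_timeReflection _, contDiff_timeReflection _,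
    ?_, ?_, ?_⟩
  · change ContDiff ℝ (⊤ : ℕ∞) fun (y : Fin (k + 1) → ℝ) i =>
      (y i + 2 * (p i 0 - p 0 0) ^ 2) + s (fun j => y j + 2 * (p j 0 - p 0 0) ^ 2)
    fun_prop
  · change ContDiff ℝ (⊤ : ℕ∞) fun (z : Fin (k + 1) → ℝ) i =>
      z i - s z - 2 * (p i 0 - p 0 0) ^ 2
    fun_prop
  · ext1 x
    refine (Equiv.symm_apply_eq H).1 ?_
    ext i
    rw [Function.comp_apply, LorDSM_timeReflection, ← ha x]
    rfl

theorem corollary2_3 (k n : ℕ) (hn : 1 ≤ n) (hnk : n < k)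
    (p : Fin (k + 1) → Fin (n + 1) → ℝ)
    (hgen : Module.finrank ℝ (recSubUpTo p (n + 1)) = n + 1) :
    AEquiv (LorDSM p) (EucDSM p) := by
  refine aEquiv_of_recSub_eq_top p (top_le_iff.1 ?_)
  have htop : recSubUpTo p (n + 1) = ⊤ := Submodule.eq_top_of_finrank_eq (by simp [hgen])
  exact htop ▸ recSubUpTo_le_recSub p (n + 1)
end
end
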